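/- For 1 ≤ q < ∞, E V_{B_qⁿ}⁴ = ((n+1)(n+2) / (2 (n!)²)) · ( Γ(1 + 3/q)² Γ(1 + n/q) / (9 Γ(1 + 1/q)⁶ Γ(1 + (n+4)/q)) )ⁿ · Γ(1 + n/q)⁴ · φ(A_q − 3, n), where A_q = 9 Γ(1 + 1/q) Γ(1 + 5/q) / (5 Γ(1 + 3/q)²) and φ(t, n) = (1 − 2t/(n+2) + t²/((n+1)(n+2))) · Σ_{k=0}^{n} t^k / k! + t^{n+1}/(n+1)! − t^{n+2}/(n+2)!. -/

import Mathlib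

open MeasureTheory Pointwise

/-- The unit ball of `ℓ_qⁿ`: `B_qⁿ = { x ∈ ℝⁿ : Σ |x_i|^q ≤ 1 }`. -/
noncomputable def lqBall (n : ℕ) (q : ℝ) : Set (EuclideanSpace ℝ (Fin n)) :=
  {x | ∑ i, |x i| ^ q ≤ 1}

/-- The uniform probability measure on a set `K` in `ℝⁿ`. -/
noncomputable def unifMeasure (n : ℕ) (K : Set (EuclideanSpace ℝ (Fin n))) :
    Measure (EuclideanSpace ℝ (Fin n)) :=
  (volume K)⁻¹ • volume.restrict K

/-- The joint distribution of `N` independent uniform random points in `K`. -/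
noncomputable def jointUnif (n N : ℕ) (K : Set (EuclideanSpace ℝ (Fin n))) :
    Measure (Fin N → EuclideanSpace ℝ (Fin n)) :=
  Measure.pi fun _ => unifMeasure n K

/-- `V_K`: the normalized volume of the symmetric convex hull of `n` points. -/
noncomputable def randCrossVol (n : ℕ) (K : Set (EuclideanSpace ℝ (Fin n)))
    (x : Fin n → EuclideanSpace ℝ (Fin n)) : ℝ :=
  (volume (convexHull ℝ (Set.range x ∪ -Set.range x))).toReal / (volume K).toReal

/-- The function `φ(t, n)` of Proposition 3.1. -/
noncomputable def phiFn (t : ℝ) (n : ℕ) : ℝ :=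
  (1 - 2 * t / ((n : ℝ) + 2) + t ^ 2 / (((n : ℝ) + 1) * ((n : ℝ) + 2))) *
      ∑ k ∈ Finset.range (n + 1), t ^ k / (k.factorial : ℝ)
    + t ^ (n + 1) / ((n + 1).factorial : ℝ) - t ^ (n + 2) / ((n + 2).factorial : ℝ)

/-- The constant `A_q = 9 Γ(1+1/q) Γ(1+5/q) / (5 Γ(1+3/q)²)`. -/
noncomputable def Aq (q : ℝ) : ℝ :=
  9 * Real.Gamma (1 + 1 / q) * Real.Gamma (1 + 5 / q) / (5 * Real.Gamma (1 + 3 / q) ^ 2)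

section

open Equiv Finset

/-- The combinatorial hyperdeterminant of a tensor `M` with four slots; it is the fourth moment of
the determinant of a matrix with i.i.d. rows whose fourth mixed moments are given by `M`. -/
noncomputable def hyperdet {n : ℕ} (M : (Fin 4 → Fin n) → ℝ) : ℝ :=
  ∑ σ : Fin 4 → Perm (Fin n), (∏ k, ((Perm.sign (σ k) : ℤ) : ℝ)) * ∏ i, M fun k => σ k i

/-- The indicator of constant index quadruples. -/
def diagTensor {n : ℕ} (f : Fin 4 → Fin n) : ℝ :=
  if f 0 = f 1 ∧ f 0 = f 2 ∧ f 0 = f 3 then 1 else 0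

/-- The fourth mixed moments of i.i.d. variables with mean `0`, variance `1` and fourth moment
`3 + t`. -/
def momentTensor {n : ℕ} (t : ℝ) (f : Fin 4 → Fin n) : ℝ :=
  (if f 0 = f 1 ∧ f 2 = f 3 then 1 else 0) + (if f 0 = f 2 ∧ f 1 = f 3 then 1 else 0) +
    (if f 0 = f 3 ∧ f 1 = f 2 then 1 else 0) + t * diagTensor f

theorem momentTensor_comp {m n : ℕ} {g : Fin m → Fin n} (hg : Function.Injective g) (t : ℝ)
    (f : Fin 4 → Fin m) : momentTensor t (fun k => g (f k)) = momentTensor t f := by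
  simp [momentTensor, diagTensor, hg.eq_iff]

theorem det_pow_four_eq_sum {n : ℕ} (X : Matrix (Fin n) (Fin n) ℝ) :
    X.det ^ 4 = ∑ σ : Fin 4 → Perm (Fin n),
      (∏ k, ((Perm.sign (σ k) : ℤ) : ℝ)) * ∏ i, ∏ k, X i (σ k i) := by
  rw [← Matrix.det_transpose, Matrix.det_apply', Fintype.sum_pow]
  simp_rw [prod_mul_distrib, Matrix.transpose_apply]
  exact sum_congr rfl fun σ _ => by rw [prod_comm]

theorem sum_diagTensor_mul {n : ℕ} (g : (Fin 4 → Fin n) → ℝ) :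
    ∑ p : Fin 4 → Fin n, diagTensor p * g p = ∑ a, g fun _ => a := by
  have h (p : Fin 4 → Fin n) : diagTensor p * g p = ∑ a, if p = fun _ => a then g p else 0 := by
    have : (p 0 = p 1 ∧ p 0 = p 2 ∧ p 0 = p 3) ↔ p = fun _ => p 0 := by
      simp only [funext_iff, Fin.forall_fin_succ]
      simp [eq_comm (b := p 0)]
    simp only [diagTensor, this]
    rw [Finset.sum_eq_single (p 0)]
    · simp
    · intro b _ hb
      rw [if_neg]
      intro hp
      exact hb (by rw [hp])
    · simp
  simp_rw [h]
  rw [sum_comm]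
  simp

theorem prod_sign_mul_right {n : ℕ} (σ : Fin 4 → Perm (Fin n)) (τ : Perm (Fin n)) :
    ∏ k, ((Perm.sign (σ k * τ) : ℤ) : ℝ) = ∏ k, ((Perm.sign (σ k) : ℤ) : ℝ) := by
  rcases Int.units_eq_one_or (Perm.sign τ) with h | h <;>
    simp [Perm.sign_mul, h, Fin.prod_univ_four]

theorem sum_diagTensor_row_zero (n : ℕ) (t : ℝ) :
    ∑ σ : Fin 4 → Perm (Fin (n + 1)), (∏ k, ((Perm.sign (σ k) : ℤ) : ℝ)) *
      ∏ j, (if j = 0 then diagTensor fun k => σ k j else momentTensor t fun k => σ k j) =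
    (n + 1) * hyperdet (n := n) (momentTensor t) := by
  rw [← ((Equiv.piCongrRight fun _ : Fin 4 => (Perm.decomposeFin (n := n)).symm).sum_comp),
    ← (Equiv.arrowProdEquivProdArrow (Fin 4) (fun _ => Fin (n + 1))
      fun _ => Perm (Fin n)).symm.sum_comp,
    Fintype.sum_prod_type]
  simp_rw [Fin.prod_univ_succ (n := n)]
  simp only [Equiv.piCongrRight_apply, Pi.map_apply, Equiv.arrowProdEquivProdArrow, coe_fn_symm_mk,
    Perm.decomposeFin_symm_apply_zero, Perm.decomposeFin_symm_apply_succ,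
    Fin.succ_ne_zero, if_true, if_false, Perm.decomposeFin.symm_sign]
  have h (p : Fin 4 → Fin (n + 1)) (A : (Fin 4 → Perm (Fin n)) → ℝ)
      (B : (Fin 4 → Perm (Fin n)) → ℝ) : ∑ e, A e * ((diagTensor fun k => p k) * B e) =
      diagTensor p * ∑ e, A e * B e := by
    rw [mul_sum]
    exact sum_congr rfl fun e _ => by ring
  simp_rw [h]
  rw [sum_diagTensor_mul fun p : Fin 4 → Fin (n + 1) => ∑ e : Fin 4 → Perm (Fin n),
    (∏ k, (((if p k = 0 then 1 else -1) * Perm.sign (e k) : ℤˣ) : ℤ) : ℝ) *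
      ∏ j : Fin n, momentTensor t fun k => swap 0 (p k) (e k j).succ]
  simp_rw [fun a (e : Fin 4 → Perm (Fin n)) (j : Fin n) => momentTensor_comp
    (g := fun x : Fin n => swap 0 a x.succ)
    ((swap 0 a).injective.comp (Fin.succ_injective n)) t fun k => e k j]
  have hs (a : Fin (n + 1)) (e : Fin 4 → Perm (Fin n)) :
      (∏ k, ((((if a = 0 then 1 else -1) * Perm.sign (e k) : ℤˣ) : ℤ) : ℝ)) =
        ∏ k, ((Perm.sign (e k) : ℤ) : ℝ) := by
    split_ifs <;> simp [Fin.prod_univ_four]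
  simp_rw [hs]
  simp [hyperdet]

theorem sum_diagTensor_row (n : ℕ) (t : ℝ) (i : Fin (n + 1)) :
    ∑ σ : Fin 4 → Perm (Fin (n + 1)), (∏ k, ((Perm.sign (σ k) : ℤ) : ℝ)) *
      ∏ j, (if j = i then diagTensor fun k => σ k j else momentTensor t fun k => σ k j) =
    (n + 1) * hyperdet (n := n) (momentTensor t) := by
  rw [← sum_diagTensor_row_zero,
    ← (Equiv.piCongrRight fun _ : Fin 4 => Equiv.mulRight (swap 0 i)).sum_comp]
  refine sum_congr rfl fun σ _ => ?_
  simp only [Equiv.piCongrRight_apply, Pi.map_apply, Equiv.coe_mulRight, prod_sign_mul_right]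
  rw [← Equiv.prod_comp (swap 0 i)]
  simp [Perm.mul_apply, Equiv.swap_apply_eq_iff]

theorem hasDerivAt_hyperdet_momentTensor (n : ℕ) (t : ℝ) :
    HasDerivAt (fun t => hyperdet (n := n + 1) (momentTensor t))
      ((n + 1) ^ 2 * hyperdet (n := n) (momentTensor t)) t := by
  have h1 (f : Fin 4 → Fin (n + 1)) :
      HasDerivAt (fun t => momentTensor t f) (diagTensor f) t := by
    simpa [momentTensor] using ((hasDerivAt_id t).mul_const (diagTensor f)).const_add
      (c := (if f 0 = f 1 ∧ f 2 = f 3 then (1 : ℝ) else 0) +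
        (if f 0 = f 2 ∧ f 1 = f 3 then 1 else 0) + if f 0 = f 3 ∧ f 1 = f 2 then 1 else 0)
  have h2 := HasDerivAt.fun_sum (u := (univ : Finset (Fin 4 → Perm (Fin (n + 1))))) fun σ _ =>
    (HasDerivAt.fun_finsetProd (u := (univ : Finset (Fin (n + 1)))) fun i _ =>
      h1 fun k => σ k i).const_mul (∏ k, ((Perm.sign (σ k) : ℤ) : ℝ))
  refine h2.congr_deriv ?_
  have h3 (σ : Fin 4 → Perm (Fin (n + 1))) (i : Fin (n + 1)) :
      (∏ j ∈ univ.erase i, momentTensor t fun k => σ k j) • diagTensor (fun k => σ k i) =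
      ∏ j, (if j = i then diagTensor fun k => σ k j else momentTensor t fun k => σ k j) := by
    rw [← mul_prod_erase univ _ (mem_univ i), if_pos rfl, smul_eq_mul, mul_comm]
    congr 1
    exact prod_congr rfl fun j hj => by rw [if_neg (ne_of_mem_erase hj)]
  simp_rw [h3, mul_sum]
  rw [sum_comm]
  simp_rw [sum_diagTensor_row]
  simp
  ring

/-- The solution of the recursion `F (n + 1)' = (n + 1) ^ 2 * F n` satisfied by the fourth moments
of random determinants. -/
noncomputable def fourthMomentPoly (n : ℕ) (t : ℝ) : ℝ :=
  (n.factorial : ℝ) ^ 2 * ∑ k ∈ range (n + 1),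
    ((n - k + 1 : ℝ) * (n - k + 2) / 2) * (t ^ k / (k.factorial : ℝ))

theorem hasDerivAt_fourthMomentPoly (n : ℕ) (t : ℝ) :
    HasDerivAt (fourthMomentPoly (n + 1)) ((n + 1) ^ 2 * fourthMomentPoly n t) t := by
  have h := (HasDerivAt.fun_sum (u := range (n + 2)) fun k _ =>
    ((hasDerivAt_pow k t).div_const (k.factorial : ℝ)).const_mul
      ((((n + 1 : ℕ) : ℝ) - k + 1) * (((n + 1 : ℕ) : ℝ) - k + 2) / 2)).const_mul
        (((n + 1).factorial : ℝ) ^ 2)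
  refine h.congr_deriv ?_
  rw [sum_range_succ', fourthMomentPoly]
  simp only [Nat.factorial_succ, Nat.cast_mul, Nat.cast_succ, Nat.cast_zero, zero_mul,
    zero_div, mul_zero, add_zero, mul_sum, Nat.add_sub_cancel]
  refine sum_congr rfl fun k _ => ?_
  have := Nat.cast_add_one_ne_zero (R := ℝ) k
  have := Nat.cast_ne_zero (R := ℝ) |>.2 k.factorial_ne_zero
  field_simp
  ring

theorem fourthMomentPoly_zero (n : ℕ) :
    fourthMomentPoly n 0 = (n.factorial : ℝ) ^ 2 * ((n + 1) * (n + 2) / 2) := by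
  rw [fourthMomentPoly, sum_range_succ']
  simp

theorem fourthMomentPoly_eq_phiFn (n : ℕ) (t : ℝ) :
    fourthMomentPoly n t = (n.factorial : ℝ) ^ 2 * (((n + 1) * (n + 2) / 2) * phiFn t n) := by
  have key (m : ℕ) (x : ℝ) : ∑ k ∈ range (m + 1),
        ((x - k + 1 : ℝ) * (x - k + 2) / 2) * (t ^ k / (k.factorial : ℝ)) =
      ((x + 1) * (x + 2) / 2 - t * (x + 1) + t ^ 2 / 2) *
          ∑ k ∈ range (m + 1), t ^ k / (k.factorial : ℝ) +
        t ^ (m + 1) / m.factorial * (x + 1 - t / 2 - m / 2) := by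
    induction m with
    | zero => simp; ring
    | succ m ih =>
      rw [sum_range_succ, ih, sum_range_succ _ (m + 1), Nat.factorial_succ]
      have := Nat.cast_add_one_ne_zero (R := ℝ) m
      have := Nat.cast_ne_zero (R := ℝ) |>.2 m.factorial_ne_zero
      push_cast
      field_simp
      ring
  rw [fourthMomentPoly, key, phiFn, Nat.factorial_succ (n + 1), Nat.factorial_succ n]
  have := Nat.cast_add_one_ne_zero (R := ℝ) n
  have := Nat.cast_ne_zero (R := ℝ) |>.2 n.factorial_ne_zero
  have : (n : ℝ) + 2 ≠ 0 := by positivity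
  have : (n : ℝ) + 1 + 1 ≠ 0 := by positivity
  push_cast
  field_simp
  ring

open Matrix in
theorem det_border_gram {m n : ℕ} (X : Matrix (Fin m) (Fin n) ℝ) (x : Fin n → ℝ) :
    (fromRows X (replicateRow Unit x) * (fromRows X (replicateRow Unit x))ᵀ).det =
      x ⬝ᵥ ((X * Xᵀ).det • 1 - Xᵀ * (X * Xᵀ).adjugate * X) *ᵥ x := by
  by_cases hA : (X * Xᵀ).det = 0
  · have hY : Xᵀ * (X * Xᵀ).adjugate * X = 0 := by
      rw [← Matrix.self_mul_conjTranspose_eq_zero, conjTranspose_eq_transpose_of_trivial]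
      have : (Xᵀ * (X * Xᵀ).adjugate * X)ᵀ = Xᵀ * (X * Xᵀ).adjugate * X := by
        simp [transpose_mul, adjugate_transpose, Matrix.mul_assoc]
      rw [this]
      calc _ = Xᵀ * ((X * Xᵀ).adjugate * (X * Xᵀ)) * (X * Xᵀ).adjugate * X := by
            simp only [Matrix.mul_assoc]
        _ = 0 := by rw [adjugate_mul, hA]; simp
    rw [hY, hA]
    simp only [zero_smul, sub_zero, zero_mulVec, dotProduct_zero]
    obtain ⟨v, hv, hv'⟩ := exists_mulVec_eq_zero_iff.2 hA
    rw [← conjTranspose_eq_transpose_of_trivial, self_mul_conjTranspose_mulVec_eq_zero,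
      conjTranspose_eq_transpose_of_trivial] at hv'
    refine exists_mulVec_eq_zero_iff.1 ⟨Sum.elim v 0, ?_, ?_⟩
    · intro h
      exact hv (funext fun i => congrFun h (Sum.inl i))
    · rw [← mulVec_mulVec, transpose_fromRows, fromCols_mulVec]
      simp [hv']
  · have : Invertible (X * Xᵀ) := invertibleOfIsUnitDet _ (isUnit_iff_ne_zero.2 hA)
    have hinv : ⅟(X * Xᵀ) = (X * Xᵀ).det⁻¹ • (X * Xᵀ).adjugate := by
      rw [invOf_eq_nonsing_inv, Matrix.inv_def, Ring.inverse_eq_inv']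
    have hdet (M : Matrix Unit Unit ℝ) : M.det = M () () := det_unique M
    have hq : (replicateRow Unit x * Xᵀ * (X * Xᵀ).adjugate * (X * (replicateRow Unit x)ᵀ)) () () =
        x ⬝ᵥ (Xᵀ * (X * Xᵀ).adjugate * X) *ᵥ x := by
      rw [← Matrix.mul_assoc, Matrix.mul_assoc (replicateRow Unit x),
        Matrix.mul_assoc (replicateRow Unit x), dotProduct_mulVec]
      rfl
    rw [transpose_fromRows, fromRows_mul_fromCols, det_fromBlocks₁₁, hdet, hinv]
    simp only [Matrix.mul_smul, Matrix.smul_mul, Matrix.sub_apply, Matrix.smul_apply, hq,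
      sub_mulVec, dotProduct_sub, smul_mulVec, one_mulVec, dotProduct_smul, smul_eq_mul, mul_sub]
    rw [mul_inv_cancel_left₀ hA]
    rfl

open Matrix in
theorem trace_gram_complement {m n : ℕ} (X : Matrix (Fin m) (Fin n) ℝ) :
    ((X * Xᵀ).det • (1 : Matrix (Fin n) (Fin n) ℝ) - Xᵀ * (X * Xᵀ).adjugate * X).trace =
      (n - m) * (X * Xᵀ).det := by
  rw [trace_sub, trace_smul, trace_one, Matrix.mul_assoc, trace_mul_comm, Matrix.mul_assoc,
    adjugate_mul, trace_smul, trace_one]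
  simp
  ring

open Matrix in
theorem gram_complement_mul_self {m n : ℕ} (X : Matrix (Fin m) (Fin n) ℝ) :
    ((X * Xᵀ).det • (1 : Matrix (Fin n) (Fin n) ℝ) - Xᵀ * (X * Xᵀ).adjugate * X) *
      ((X * Xᵀ).det • (1 : Matrix (Fin n) (Fin n) ℝ) - Xᵀ * (X * Xᵀ).adjugate * X) =
    (X * Xᵀ).det • ((X * Xᵀ).det • (1 : Matrix (Fin n) (Fin n) ℝ) -
      Xᵀ * (X * Xᵀ).adjugate * X) := by
  have h : Xᵀ * (X * Xᵀ).adjugate * X * (Xᵀ * (X * Xᵀ).adjugate * X) =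
      (X * Xᵀ).det • (Xᵀ * (X * Xᵀ).adjugate * X) := by
    calc _ = Xᵀ * ((X * Xᵀ).adjugate * (X * Xᵀ)) * (X * Xᵀ).adjugate * X := by
          simp only [Matrix.mul_assoc]
      _ = _ := by rw [adjugate_mul]; simp
  simp [Matrix.sub_mul, Matrix.mul_sub, h]

/-- The number of slots of `f` equal to `i`. -/
def slotCount {n : ℕ} (f : Fin 4 → Fin n) (i : Fin n) : ℕ := ∑ k, if f k = i then 1 else 0

theorem prod_pow_slotCount {n : ℕ} (f : Fin 4 → Fin n) (x : Fin n → ℝ) :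
    ∏ i, x i ^ slotCount f i = ∏ k, x (f k) := by
  simp_rw [slotCount, ← prod_pow_eq_pow_sum]
  rw [prod_comm]
  refine prod_congr rfl fun k _ => ?_
  rw [Finset.prod_eq_single (f k)] <;> simp +contextual [eq_comm]

theorem prod_moment_slotCount {n : ℕ} (μ : ℕ → ℝ) (h0 : μ 0 = 1) (h1 : μ 1 = 0) (h3 : μ 3 = 0)
    (h2 : μ 2 ≠ 0) (f : Fin 4 → Fin n) :
    ∏ i, μ (slotCount f i) = μ 2 ^ 2 * momentTensor (μ 4 / μ 2 ^ 2 - 3) f := by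
  have hs : ∏ i, μ (slotCount f i) = ∏ i ∈ {f 0, f 1, f 2, f 3}, μ (slotCount f i) := by
    refine (prod_subset (subset_univ _) fun i _ hi => ?_).symm
    simp only [mem_insert, mem_singleton, not_or] at hi
    have : slotCount f i = 0 := by
      simp [slotCount, Fin.forall_fin_succ, hi, eq_comm (b := i)]
    rw [this, h0]
  have hd : μ 2 ^ 2 * (μ 4 / μ 2 ^ 2 - 3) = μ 4 - 3 * μ 2 ^ 2 := by field_simp
  rw [hs]
  simp only [slotCount, Fin.sum_univ_four, momentTensor, diagTensor]
  generalize f 0 = a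
  generalize f 1 = b
  generalize f 2 = c
  generalize f 3 = d
  rcases eq_or_ne a b with rfl | hab
  · rcases eq_or_ne a c with rfl | hac
    · rcases eq_or_ne a d with rfl | had
      · simp only [mul_add, ← mul_assoc, hd]
        simp
        ring
      · simp [had, had.symm, h1, h3]
    · rcases eq_or_ne a d with rfl | had
      · simp [hac, hac.symm, h1, h3]
      · rcases eq_or_ne c d with rfl | hcd
        · simp [hac, hac.symm, sq]
        · simp [hac, hac.symm, had, had.symm, hcd, hcd.symm, h1]
  · rcases eq_or_ne a c with rfl | hac
    · rcases eq_or_ne a d with rfl | had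
      · simp [hab, hab.symm, h1, h3]
      · rcases eq_or_ne b d with rfl | hbd
        · simp [hab, hab.symm, sq]
        · simp [hab, hab.symm, had, had.symm, hbd, hbd.symm, h1]
    · rcases eq_or_ne a d with rfl | had
      · rcases eq_or_ne b c with rfl | hbc
        · simp [hab, hab.symm, sq]
        · simp [hab, hab.symm, hac, hac.symm, hbc, hbc.symm, h1]
      · rw [prod_insert (by simp [hab, hac, had])]
        simp [hab, hac, had, hab.symm, hac.symm, had.symm, h1]

open Matrix in
theorem det_gram_vecCons {m n : ℕ} (X : Fin m → Fin n → ℝ) (x : Fin n → ℝ) :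
    (of (vecCons x X) * (of (vecCons x X))ᵀ).det =
      x ⬝ᵥ ((of X * (of X)ᵀ).det • 1 - (of X)ᵀ * (of X * (of X)ᵀ).adjugate * of X) *ᵥ x := by
  rw [← det_border_gram, ← det_submatrix_equiv_self
    ((finSuccEquiv m).trans (Equiv.optionEquivSumPUnit.{0} (Fin m)))]
  congr 1
  ext i j
  refine Fin.cases ?_ (fun i => ?_) i <;> refine Fin.cases ?_ (fun j => ?_) j <;>
    simp [mul_apply]

open Matrix in
theorem sum_quadForm_sq {n : ℕ} {Ω : Type*} [Fintype Ω] (W : Ω → ℝ) (v : Ω → Fin n → ℝ)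
    (hv : ∀ f : Fin 4 → Fin n, ∑ s, W s * ∏ k, v s (f k) = momentTensor 0 f)
    (Q : Matrix (Fin n) (Fin n) ℝ) (hQ : Qᵀ = Q) :
    ∑ s, W s * (v s ⬝ᵥ Q *ᵥ v s) ^ 2 = Q.trace ^ 2 + 2 * (Q * Q).trace := by
  have hQ' (a b : Fin n) : Q b a = Q a b := congrFun (congrFun hQ a) b
  have h1 (s : Ω) : W s * (v s ⬝ᵥ Q *ᵥ v s) ^ 2 = ∑ a, ∑ b, ∑ c, ∑ d,
      Q a b * Q c d * (W s * ∏ k, v s (![a, b, c, d] k)) := by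
    have hq : v s ⬝ᵥ Q *ᵥ v s = ∑ a, ∑ b, Q a b * (v s a * v s b) := by
      simp only [dotProduct, mulVec, mul_sum]
      exact sum_congr rfl fun a _ => sum_congr rfl fun b _ => by ring
    rw [hq, sq, sum_mul, mul_sum]
    refine sum_congr rfl fun a _ => ?_
    rw [sum_mul, mul_sum]
    refine sum_congr rfl fun b _ => ?_
    rw [mul_sum, mul_sum]
    refine sum_congr rfl fun c _ => ?_
    rw [mul_sum, mul_sum]
    refine sum_congr rfl fun d _ => ?_
    simp [Fin.prod_univ_four]
    ring
  have h2 : ∑ s, W s * (v s ⬝ᵥ Q *ᵥ v s) ^ 2 = ∑ a, ∑ b, ∑ c, ∑ d,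
      Q a b * Q c d * momentTensor 0 ![a, b, c, d] := by
    simp_rw [h1, ← hv, mul_sum]
    rw [sum_comm]
    refine sum_congr rfl fun a _ => ?_
    rw [sum_comm]
    refine sum_congr rfl fun b _ => ?_
    rw [sum_comm]
    refine sum_congr rfl fun c _ => ?_
    rw [sum_comm]
  have hm (a b c d : Fin n) : momentTensor 0 ![a, b, c, d] =
      (if a = b then if c = d then 1 else 0 else 0) +
        (if a = c then if b = d then 1 else 0 else 0) +
        (if a = d then if b = c then 1 else 0 else 0) := by
    simp only [momentTensor, zero_mul, add_zero, ite_and]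
    rfl
  rw [h2]
  simp only [hm, mul_add, sum_add_distrib, trace, Matrix.diag, Matrix.mul_apply, mul_ite,
    mul_one, mul_zero, sum_ite_eq, mem_univ, if_true, sum_ite_irrel, sum_const_zero, hQ', sq,
    sum_mul_sum, two_mul, add_assoc]

open Matrix in
theorem sum_det_gram_sq {n : ℕ} {Ω : Type*} [Fintype Ω] (W : Ω → ℝ) (v : Ω → Fin n → ℝ)
    (hv : ∀ f : Fin 4 → Fin n, ∑ s, W s * ∏ k, v s (f k) = momentTensor 0 f) (m : ℕ) :
    ∑ ω : Fin m → Ω, (∏ i, W (ω i)) *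
        ((of fun i => v (ω i)) * (of fun i => v (ω i))ᵀ).det ^ 2 =
      ∏ d ∈ range m, ((n - d : ℝ) * (n - d + 2)) := by
  induction m with
  | zero => simp
  | succ m ih =>
    rw [prod_range_succ, ← ih, ← (Fin.consEquiv fun _ => Ω).sum_comp, Fintype.sum_prod_type,
      sum_comm, sum_mul]
    refine sum_congr rfl fun ω _ => ?_
    have hc (s : Ω) : (fun i => v ((Fin.consEquiv fun _ => Ω) (s, ω) i)) =
        vecCons (v s) fun i => v (ω i) := by
      ext i
      refine Fin.cases ?_ (fun i => ?_) i <;> simp [Fin.consEquiv]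
    have hw (s : Ω) : ∏ i, W ((Fin.consEquiv fun _ => Ω) (s, ω) i) = W s * ∏ i, W (ω i) := by
      simp [Fin.prod_univ_succ, Fin.consEquiv]
    simp_rw [hc, hw, det_gram_vecCons]
    generalize hX : (fun i => v (ω i)) = X
    have := sum_quadForm_sq W v hv
      ((of X * (of X)ᵀ).det • 1 - (of X)ᵀ * (of X * (of X)ᵀ).adjugate * of X)
      (by simp [transpose_mul, adjugate_transpose, Matrix.mul_assoc])
    rw [gram_complement_mul_self, trace_smul, trace_gram_complement] at this
    simp_rw [fun s => mul_right_comm (W s) (∏ i, W (ω i))]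
    rw [← sum_mul, this, smul_eq_mul]
    ring

/-- A discrete law with mean `0`, variance `1` and fourth moment `3`, like the Gaussian. -/
theorem exists_gaussian_moments (n : ℕ) : ∃ (W : (Fin n → Fin 3) → ℝ)
    (v : (Fin n → Fin 3) → Fin n → ℝ),
    ∀ f : Fin 4 → Fin n, ∑ s, W s * ∏ k, v s (f k) = momentTensor 0 f := by
  let w : Fin 3 → ℝ := ![1 / 6, 2 / 3, 1 / 6]
  let u : Fin 3 → ℝ := ![-√3, 0, √3]
  refine ⟨fun s => ∏ i, w (s i), fun s i => u (s i), fun f => ?_⟩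
  have h (s : Fin n → Fin 3) : (∏ i, w (s i)) * ∏ k, u (s (f k)) =
      ∏ i, w (s i) * u (s i) ^ slotCount f i := by
    rw [prod_mul_distrib, prod_pow_slotCount f fun i => u (s i)]
  have h3 : √3 ^ 2 = (3 : ℝ) := Real.sq_sqrt (by norm_num)
  have h4 : √3 ^ 4 = (9 : ℝ) := by rw [show 4 = 2 * 2 from rfl, pow_mul, h3]; norm_num
  simp_rw [h]
  rw [← Fintype.piFinset_univ, ← prod_univ_sum (fun _ : Fin n => (univ : Finset (Fin 3)))
    fun i j => w j * u j ^ slotCount f i]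
  rw [prod_moment_slotCount (fun d => ∑ j, w j * u j ^ d)]
  · simp only [Fin.sum_univ_three, w, u]
    simp [h3, h4, Even.neg_pow (show Even 4 by decide)]
    norm_num
  · simp only [Fin.sum_univ_three, w, u]
    simp
    norm_num
  · simp only [Fin.sum_univ_three, w, u]
    simp
  · simp only [Fin.sum_univ_three, w, u]
    simp [Odd.neg_pow (show Odd 3 by decide)]
  · simp only [Fin.sum_univ_three, w, u]
    simp [h3]

theorem hyperdet_momentTensor_zero (n : ℕ) :
    hyperdet (n := n) (momentTensor 0) = fourthMomentPoly n 0 := by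
  obtain ⟨W, v, hv⟩ := exists_gaussian_moments n
  have h : hyperdet (n := n) (momentTensor 0) = ∑ ω : Fin n → Fin n → Fin 3, (∏ i, W (ω i)) *
      ((Matrix.of fun i => v (ω i)) * (Matrix.of fun i => v (ω i)).transpose).det ^ 2 := by
    simp_rw [hyperdet, ← hv, prod_univ_sum, Fintype.piFinset_univ, Matrix.det_mul,
      Matrix.det_transpose, ← sq, ← pow_mul, show 2 * 2 = 4 from rfl, det_pow_four_eq_sum, mul_sum]
    rw [sum_comm]
    refine sum_congr rfl fun ω _ => sum_congr rfl fun σ _ => ?_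
    rw [prod_mul_distrib, mul_left_comm]
    rfl
  rw [h, sum_det_gram_sq W v hv, fourthMomentPoly_zero]
  have key (m : ℕ) : ∏ d ∈ range m, ((m - d : ℝ) * (m - d + 2)) =
      (m.factorial : ℝ) ^ 2 * ((m + 1) * (m + 2) / 2) := by
    induction m with
    | zero => simp
    | succ m ih =>
      rw [prod_range_succ']
      have (d : ℕ) : (((m + 1 : ℕ) : ℝ) - (d + 1 : ℕ)) * (((m + 1 : ℕ) : ℝ) - (d + 1 : ℕ) + 2) =
          (m - d : ℝ) * (m - d + 2) := by push_cast; ring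
      simp_rw [this]
      rw [ih, Nat.factorial_succ]
      push_cast
      ring
  exact key n

theorem hyperdet_momentTensor (n : ℕ) (t : ℝ) :
    hyperdet (n := n) (momentTensor t) = fourthMomentPoly n t := by
  induction n generalizing t with
  | zero => simp [hyperdet, fourthMomentPoly]
  | succ n ih =>
    have h (s : ℝ) : HasDerivAt (fun s => hyperdet (n := n + 1) (momentTensor s) -
        fourthMomentPoly (n + 1) s) 0 s := by
      refine ((hasDerivAt_hyperdet_momentTensor n s).sub
        (hasDerivAt_fourthMomentPoly n s)).congr_deriv ?_
      rw [ih, sub_self]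
    have h2 := is_const_of_deriv_eq_zero (fun s => (h s).differentiableAt)
      (fun s => (h s).deriv) t 0
    rw [hyperdet_momentTensor_zero, sub_self] at h2
    exact sub_eq_zero.1 h2

theorem measurableSet_sum_rpow_le (n : ℕ) {q : ℝ} (hq : 0 ≤ q) (s : ℝ) :
    MeasurableSet {x : Fin n → ℝ | ∑ i, |x i| ^ q ≤ s} := by
  refine (isClosed_le (continuous_finsetSum _ fun i _ => ?_) continuous_const).measurableSet
  exact (continuous_apply i).abs.rpow_const fun _ => Or.inr hq

theorem lqBall_eq_preimage (n : ℕ) (q : ℝ) :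
    lqBall n q = WithLp.ofLp ⁻¹' {x : Fin n → ℝ | ∑ i, |x i| ^ q ≤ 1} := rfl

theorem volume_lqBall {n : ℕ} (hn : 0 < n) {q : ℝ} (hq : 1 ≤ q) :
    volume (lqBall n q) = ENNReal.ofReal
      ((2 * Real.Gamma (1 + 1 / q)) ^ n / Real.Gamma (1 + n / q)) := by
  have : Nonempty (Fin n) := ⟨⟨0, hn⟩⟩
  have hq0 : 0 < q := by linarith
  have h := volume_sum_rpow_le (Fin n) hq 1
  rw [lqBall_eq_preimage, (PiLp.volume_preserving_ofLp (Fin n)).measure_preimage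
    (measurableSet_sum_rpow_le n hq0.le 1).nullMeasurableSet]
  have hset : {x : Fin n → ℝ | ∑ i, |x i| ^ q ≤ 1} =
      {x : Fin n → ℝ | (∑ i, |x i| ^ q) ^ (1 / q) ≤ 1} := by
    ext x
    have h0 : 0 ≤ ∑ i, |x i| ^ q := sum_nonneg fun i _ => by positivity
    simp only [Set.mem_ofPred_eq]
    rw [← Real.rpow_le_rpow_iff h0 zero_le_one (one_div_pos.2 hq0), Real.one_rpow]
  rw [hset, h]
  simp [add_comm]

theorem sum_smul_mem_absConvexHull {E : Type*} [AddCommGroup E] [Module ℝ E] {n : ℕ}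
    (hn : 0 < n) (x : Fin n → E) (c : Fin n → ℝ) (hc : ∑ i, |c i| ≤ 1) :
    ∑ i, c i • x i ∈ absConvexHull ℝ (Set.range x) := by
  have hbal : Balanced ℝ (absConvexHull ℝ (Set.range x)) := balanced_absConvexHull
  have hx (i : Fin n) : x i ∈ absConvexHull ℝ (Set.range x) :=
    subset_absConvexHull ⟨i, rfl⟩
  have h0 : 0 ≤ ∑ i, |c i| := sum_nonneg fun i _ => abs_nonneg _
  rcases h0.eq_or_lt with h | h
  · have hz : ∑ i, c i • x i = 0 := sum_eq_zero fun i _ => by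
      have := (sum_eq_zero_iff_of_nonneg fun i _ => abs_nonneg (c i)).1 h.symm i (mem_univ i)
      rw [abs_eq_zero.1 this, zero_smul]
    rw [hz]
    exact hbal.zero_mem ⟨_, hx ⟨0, hn⟩⟩
  · have hy (i : Fin n) : (SignType.sign (c i) : ℝ) • x i ∈ absConvexHull ℝ (Set.range x) := by
      refine hbal.smul_mem ?_ (hx i)
      cases SignType.sign (c i) <;> simp
    have hm := convex_absConvexHull.sum_mem (t := univ) (w := fun i => (∑ j, |c j|)⁻¹ * |c i|)
      (fun i _ => by positivity) (by rw [← mul_sum, inv_mul_cancel₀ h.ne'])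
      (fun i _ => hy i)
    have := hbal.smul_mem (a := ∑ i, |c i|) (by rwa [Real.norm_eq_abs, abs_of_pos h]) hm
    convert this using 1
    rw [smul_sum]
    refine sum_congr rfl fun i _ => ?_
    rw [smul_smul, smul_smul, mul_inv_cancel_left₀ h.ne', mul_comm, sign_mul_abs]

theorem convexHull_eq_image_lqBall {n : ℕ} (hn : 0 < n)
    (x : Fin n → EuclideanSpace ℝ (Fin n)) :
    convexHull ℝ (Set.range x ∪ -Set.range x) =
      Matrix.toLpLin 2 2 (Matrix.of fun i j => x i j).transpose '' lqBall n 1 := by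
  have hL (c : EuclideanSpace ℝ (Fin n)) :
      Matrix.toLpLin 2 2 (Matrix.of fun i j => x i j).transpose c = ∑ i, c i • x i := by
    ext j
    simp [Matrix.mulVec, dotProduct, mul_comm]
  rw [convexHull_union_neg_eq_absConvexHull]
  refine Set.Subset.antisymm (absConvexHull_min ?_ ⟨?_, ?_⟩) ?_
  · rintro _ ⟨i, rfl⟩
    refine ⟨EuclideanSpace.single i 1, ?_, ?_⟩
    · simp [lqBall, apply_ite abs]
    · rw [hL]
      simp
  · rintro a ha _ ⟨_, ⟨c, hc, rfl⟩, rfl⟩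
    refine ⟨a • c, ?_, map_smul _ _ _⟩
    simp only [lqBall, Set.mem_ofPred_eq, Real.rpow_one] at hc ⊢
    simp only [PiLp.smul_apply, smul_eq_mul, abs_mul, ← mul_sum]
    exact mul_le_one₀ ha (sum_nonneg fun i _ => abs_nonneg _) hc
  · refine Convex.linear_image ?_ _
    intro c hc d hd a b ha hb hab
    simp only [lqBall, Set.mem_ofPred_eq, Real.rpow_one] at hc hd ⊢
    calc ∑ i, |(a • c + b • d) i| ≤ ∑ i, (a * |c i| + b * |d i|) := by
          refine sum_le_sum fun i _ => ?_
          refine (abs_add_le _ _).trans (le_of_eq ?_)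
          simp [abs_mul, abs_of_nonneg ha, abs_of_nonneg hb]
      _ = a * ∑ i, |c i| + b * ∑ i, |d i| := by rw [sum_add_distrib, mul_sum, mul_sum]
      _ ≤ a * 1 + b * 1 := by gcongr
      _ = 1 := by rw [mul_one, mul_one, hab]
  · rintro _ ⟨c, hc, rfl⟩
    rw [hL]
    exact sum_smul_mem_absConvexHull hn x _ (by simpa [lqBall] using hc)

theorem volume_convexHull_range_union_neg {n : ℕ} (hn : 0 < n)
    (x : Fin n → EuclideanSpace ℝ (Fin n)) :
    (volume (convexHull ℝ (Set.range x ∪ -Set.range x))).toReal =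
      2 ^ n / n.factorial * |(Matrix.of fun i j => x i j).det| := by
  rw [convexHull_eq_image_lqBall hn, Measure.addHaar_image_linearMap, volume_lqBall hn le_rfl,
    LinearMap.det_toLpLin, Matrix.det_transpose, ENNReal.toReal_mul,
    ENNReal.toReal_ofReal (abs_nonneg _), ENNReal.toReal_ofReal, mul_comm]
  · congr 2
    · norm_num [Real.Gamma_two]
    · rw [div_one, add_comm, Real.Gamma_nat_eq_factorial]
  · rw [div_one, div_one, add_comm (1 : ℝ) n, Real.Gamma_nat_eq_factorial]
    positivity

theorem integral_even_pow_mul_exp_neg_abs_rpow {q : ℝ} (hq : 0 < q) {k : ℕ} (hk : Even k) :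
    ∫ x : ℝ, x ^ k * Real.exp (-|x| ^ q) = 2 / (k + 1) * Real.Gamma (1 + (k + 1) / q) := by
  have h := integral_comp_abs (f := fun x : ℝ => x ^ (k : ℝ) * Real.exp (-x ^ q))
  simp only [Real.rpow_natCast, hk.pow_abs] at h
  have hk1 : (0 : ℝ) < k + 1 := by positivity
  rw [h]
  simp only [← Real.rpow_natCast]
  rw [integral_rpow_mul_exp_neg_rpow hq (by linarith), add_comm (1 : ℝ),
    Real.Gamma_add_one (by positivity)]
  field_simp

theorem integral_odd_pow_mul_exp_neg_abs_rpow (q : ℝ) {k : ℕ} (hk : Odd k) :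
    ∫ x : ℝ, x ^ k * Real.exp (-|x| ^ q) = 0 := by
  have h := integral_neg_eq_self (fun x : ℝ => x ^ k * Real.exp (-|x| ^ q)) volume
  simp only [hk.neg_pow, abs_neg, neg_mul, integral_neg] at h
  linarith

theorem integrable_pow_mul_exp_neg_abs_rpow {q : ℝ} (hq : 0 < q) (k : ℕ) :
    Integrable fun x : ℝ => x ^ k * Real.exp (-|x| ^ q) := by
  have hk1 : (0 : ℝ) < k + 1 := by positivity
  have h : Integrable fun x : ℝ => |x| ^ k * Real.exp (-|x| ^ q) := by
    refine Integrable.of_integral_ne_zero ?_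
    have h := integral_comp_abs (f := fun x : ℝ => x ^ (k : ℝ) * Real.exp (-x ^ q))
    simp only [Real.rpow_natCast] at h
    rw [h]
    simp only [← Real.rpow_natCast]
    rw [integral_rpow_mul_exp_neg_rpow hq (by linarith)]
    have := Real.Gamma_pos_of_pos (div_pos hk1 hq)
    positivity
  refine h.mono' (Continuous.aestronglyMeasurable ?_) (Filter.Eventually.of_forall fun x => ?_)
  · exact (continuous_pow k).mul
      (Real.continuous_exp.comp (continuous_abs.rpow_const fun _ => Or.inr hq.le).neg)
  · simp

theorem integral_mul_exp_neg_eq_integral_setIntegral {E : Type*} [MeasurableSpace E]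
    {μ : Measure E} [SFinite μ] {p N : E → ℝ} (hp : Measurable p) (hN : Measurable N)
    (hN0 : ∀ x, 0 ≤ N x) (hi : Integrable (fun x => p x * Real.exp (-N x)) μ) :
    ∫ x, p x * Real.exp (-N x) ∂μ =
      ∫ s in Set.Ioi (0 : ℝ), Real.exp (-s) * ∫ x in {x | N x ≤ s}, p x ∂μ := by
  let G : E → ℝ → ℝ := fun x s =>
    {z : E × ℝ | N z.1 ≤ z.2}.indicator (fun z => p z.1 * Real.exp (-z.2)) (x, s)
  have hGx (x : E) : G x = (Set.Ici (N x)).indicator fun s => p x * Real.exp (-s) := by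
    ext s
    simp [G, Set.indicator]
  have hGs (s : ℝ) : (fun x => G x s) = {x | N x ≤ s}.indicator fun x => Real.exp (-s) * p x := by
    ext x
    simp [G, Set.indicator, mul_comm]
  have hG : AEStronglyMeasurable (Function.uncurry G) (μ.prod volume) := by
    refine (Measurable.indicator ?_ ?_).aestronglyMeasurable
    · fun_prop
    · exact measurableSet_le (hN.comp measurable_fst) measurable_snd
  have hexp (a c : ℝ) : ∫ s, (Set.Ici a).indicator (fun s => c * Real.exp (-s)) s =
      c * Real.exp (-a) := by
    rw [integral_indicator measurableSet_Ici, integral_Ici_eq_integral_Ioi,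
      integral_const_mul, integral_exp_neg_Ioi]
  have hGint : Integrable (Function.uncurry G) (μ.prod volume) := by
    refine (integrable_prod_iff hG).2 ⟨Filter.Eventually.of_forall fun x => ?_, ?_⟩
    · simp only [Function.uncurry_apply_pair, hGx]
      refine (integrable_indicator_iff measurableSet_Ici).2 ?_
      exact ((integrableOn_Ici_iff_integrableOn_Ioi (by simp)).2
        (integrableOn_exp_neg_Ioi _)).const_mul _
    · refine hi.norm.congr (Filter.Eventually.of_forall fun x => ?_)
      simp only [Function.uncurry_apply_pair, hGx, norm_indicator_eq_indicator_norm, norm_mul,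
        Real.norm_eq_abs, Real.abs_exp]
      exact (hexp _ _).symm
  calc ∫ x, p x * Real.exp (-N x) ∂μ = ∫ x, (∫ s, G x s) ∂μ := by
        simp only [hGx, hexp]
    _ = ∫ s, ∫ x, G x s ∂μ := integral_integral_swap hGint
    _ = ∫ s, Real.exp (-s) * ∫ x in {x | N x ≤ s}, p x ∂μ := by
        refine integral_congr_ae (Filter.Eventually.of_forall fun s => ?_)
        simp only [hGs]
        rw [integral_indicator (measurableSet_le hN measurable_const), integral_const_mul]
    _ = ∫ s in Set.Ici (0 : ℝ), Real.exp (-s) * ∫ x in {x | N x ≤ s}, p x ∂μ := by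
        refine (setIntegral_eq_integral_of_forall_compl_eq_zero fun s hs => ?_).symm
        have : {x | N x ≤ s} = ∅ :=
          Set.eq_empty_of_forall_notMem fun x hx => hs ((hN0 x).trans hx)
        rw [this, setIntegral_empty, mul_zero]
    _ = _ := integral_Ici_eq_integral_Ioi

theorem setIntegral_sublevel_eq_rpow_mul {n : ℕ} {q : ℝ} (hq : 0 < q) (f : Fin 4 → Fin n)
    {s : ℝ} (hs : 0 < s) :
    ∫ x in {x : Fin n → ℝ | ∑ i, |x i| ^ q ≤ s}, ∏ k, x (f k) =
      s ^ ((n + 4) / q) * ∫ x in {x : Fin n → ℝ | ∑ i, |x i| ^ q ≤ 1}, ∏ k, x (f k) := by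
  have hR : 0 < s ^ (1 / q) := Real.rpow_pos_of_pos hs _
  have h := Measure.setIntegral_comp_smul_of_pos volume (fun x : Fin n → ℝ => ∏ k, x (f k))
    {x : Fin n → ℝ | ∑ i, |x i| ^ q ≤ 1} hR
  have hset : s ^ (1 / q) • {x : Fin n → ℝ | ∑ i, |x i| ^ q ≤ 1} =
      {x : Fin n → ℝ | ∑ i, |x i| ^ q ≤ s} := by
    ext x
    rw [Set.mem_smul_set_iff_inv_smul_mem₀ hR.ne']
    simp only [Set.mem_ofPred_eq, Pi.smul_apply, smul_eq_mul, abs_mul, abs_inv, abs_of_pos hR]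
    simp_rw [Real.mul_rpow (inv_nonneg.2 hR.le) (abs_nonneg _), Real.inv_rpow hR.le]
    rw [← Real.rpow_mul hs.le, one_div_mul_cancel hq.ne', Real.rpow_one, ← mul_sum,
      inv_mul_le_iff₀ hs, mul_one]
  rw [hset] at h
  simp only [Pi.smul_apply, smul_eq_mul, prod_mul_distrib, prod_const, card_univ,
    Fintype.card_fin, integral_const_mul, Module.finrank_fin_fun] at h
  rw [eq_inv_mul_iff_mul_eq₀ (by positivity), ← mul_assoc, ← pow_add, ← Real.rpow_natCast,
    ← Real.rpow_mul hs.le] at h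
  rw [← h]
  congr 2
  push_cast
  ring

theorem integral_rpow_mul_exp_neg_Ioi {a : ℝ} (ha : 0 < a) :
    ∫ s in Set.Ioi (0 : ℝ), Real.exp (-s) * s ^ a = Real.Gamma (1 + a) := by
  rw [Real.Gamma_eq_integral (by linarith), add_sub_cancel_left]

/-- The moments of the weight `exp (-|x| ^ q)` on the line. -/
noncomputable def expMoment (q : ℝ) (k : ℕ) : ℝ :=
  ∫ x : ℝ, x ^ k * Real.exp (-|x| ^ q)

theorem integrable_prod_mul_exp_neg {n : ℕ} {q : ℝ} (hq : 0 < q) (f : Fin 4 → Fin n) :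
    Integrable fun x : Fin n → ℝ => (∏ k, x (f k)) * Real.exp (-∑ i, |x i| ^ q) := by
  have h := Integrable.fintype_prod (μ := fun _ : Fin n => (volume : Measure ℝ))
    fun i => integrable_pow_mul_exp_neg_abs_rpow hq (slotCount f i)
  refine h.congr (Filter.Eventually.of_forall fun x => ?_)
  simp only [prod_mul_distrib, prod_pow_slotCount, ← Real.exp_sum, sum_neg_distrib]

theorem integral_prod_mul_exp_neg {n : ℕ} (q : ℝ) (f : Fin 4 → Fin n) :
    ∫ x : Fin n → ℝ, (∏ k, x (f k)) * Real.exp (-∑ i, |x i| ^ q) =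
      ∏ i, expMoment q (slotCount f i) := by
  simp only [expMoment]
  rw [← integral_fintype_prod_volume_eq_prod
    fun i (x : ℝ) => x ^ slotCount f i * Real.exp (-|x| ^ q)]
  simp only [prod_mul_distrib, prod_pow_slotCount, ← Real.exp_sum, sum_neg_distrib]

theorem prod_expMoment_slotCount {n : ℕ} {q : ℝ} (hq : 0 < q) (f : Fin 4 → Fin n) :
    ∏ i, expMoment q (slotCount f i) = (2 * Real.Gamma (1 + 1 / q)) ^ n *
      (Real.Gamma (1 + 3 / q) / (3 * Real.Gamma (1 + 1 / q))) ^ 2 *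
        momentTensor (Aq q - 3) f := by
  have e0 : expMoment q 0 = 2 * Real.Gamma (1 + 1 / q) := by
    rw [expMoment, integral_even_pow_mul_exp_neg_abs_rpow hq (by decide)]
    norm_num
  have e2 : expMoment q 2 = 2 / 3 * Real.Gamma (1 + 3 / q) := by
    rw [expMoment, integral_even_pow_mul_exp_neg_abs_rpow hq (by decide)]
    norm_num
  have e4 : expMoment q 4 = 2 / 5 * Real.Gamma (1 + 5 / q) := by
    rw [expMoment, integral_even_pow_mul_exp_neg_abs_rpow hq (by decide)]
    norm_num
  have g1 : 0 < Real.Gamma (1 + 1 / q) := Real.Gamma_pos_of_pos (by positivity)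
  have g3 : 0 < Real.Gamma (1 + 3 / q) := Real.Gamma_pos_of_pos (by positivity)
  have h := prod_moment_slotCount (fun k => expMoment q k / expMoment q 0)
    (div_self (by rw [e0]; positivity))
    (by rw [expMoment, integral_odd_pow_mul_exp_neg_abs_rpow q (by decide), zero_div])
    (by rw [expMoment, integral_odd_pow_mul_exp_neg_abs_rpow q (by decide), zero_div])
    (by rw [e0, e2]; positivity) f
  simp only [prod_div_distrib, prod_const, card_univ, Fintype.card_fin, e0, e2, e4] at h
  rw [div_eq_iff (by positivity)] at h
  have hA : 2 / 5 * Real.Gamma (1 + 5 / q) / (2 * Real.Gamma (1 + 1 / q)) /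
      (2 / 3 * Real.Gamma (1 + 3 / q) / (2 * Real.Gamma (1 + 1 / q))) ^ 2 = Aq q := by
    rw [Aq]
    field_simp
    norm_num
  have hB : 2 / 3 * Real.Gamma (1 + 3 / q) / (2 * Real.Gamma (1 + 1 / q)) =
      Real.Gamma (1 + 3 / q) / (3 * Real.Gamma (1 + 1 / q)) := by
    field_simp
  rw [h, hA, hB]
  ring

theorem setIntegral_sublevel_one {n : ℕ} {q : ℝ} (hq : 0 < q) (f : Fin 4 → Fin n) :
    Real.Gamma (1 + (n + 4) / q) *
        ∫ x in {x : Fin n → ℝ | ∑ i, |x i| ^ q ≤ 1}, ∏ k, x (f k) =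
      ∏ i, expMoment q (slotCount f i) := by
  have hN : Continuous fun x : Fin n → ℝ => ∑ i, |x i| ^ q :=
    continuous_finsetSum _ fun i _ => (continuous_apply i).abs.rpow_const fun _ => Or.inr hq.le
  have hp : Continuous fun x : Fin n → ℝ => ∏ k, x (f k) :=
    continuous_finsetProd _ fun k _ => continuous_apply _
  rw [← integral_prod_mul_exp_neg, integral_mul_exp_neg_eq_integral_setIntegral hp.measurable
    hN.measurable (fun x => sum_nonneg fun i _ => by positivity) (integrable_prod_mul_exp_neg hq f),
    ← integral_rpow_mul_exp_neg_Ioi (by positivity), ← integral_mul_const]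
  refine setIntegral_congr_fun measurableSet_Ioi fun s hs => ?_
  simp only [setIntegral_sublevel_eq_rpow_mul hq f hs, mul_assoc]

theorem integrableOn_sublevel_one {n : ℕ} {q : ℝ} (hq : 0 < q) (f : Fin 4 → Fin n) :
    IntegrableOn (fun x : Fin n → ℝ => ∏ k, x (f k)) {x | ∑ i, |x i| ^ q ≤ 1} := by
  have hp : Continuous fun x : Fin n → ℝ => ∏ k, x (f k) :=
    continuous_finsetProd _ fun k _ => continuous_apply _
  refine ((integrable_prod_mul_exp_neg hq f).norm.const_mul (Real.exp 1)).integrableOn.mono'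
    hp.aestronglyMeasurable ?_
  refine (ae_restrict_iff' (measurableSet_sum_rpow_le n hq.le 1)).2
    (Filter.Eventually.of_forall fun x hx => ?_)
  have : 1 ≤ Real.exp 1 * Real.exp (-∑ i, |x i| ^ q) := by
    rw [← Real.exp_add]
    exact Real.one_le_exp (by linarith [Set.mem_ofPred_eq ▸ hx])
  rw [norm_mul, Real.norm_eq_abs (Real.exp _), Real.abs_exp, mul_left_comm]
  exact le_mul_of_one_le_right (norm_nonneg _) this

theorem integral_unifMeasure_lqBall {n : ℕ} (hn : 0 < n) {q : ℝ} (hq : 1 ≤ q)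
    (f : Fin 4 → Fin n) :
    ∫ x, ∏ k, x (f k) ∂(unifMeasure n (lqBall n q)) =
      Real.Gamma (1 + 3 / q) ^ 2 * Real.Gamma (1 + n / q) /
        (9 * Real.Gamma (1 + 1 / q) ^ 2 * Real.Gamma (1 + (n + 4) / q)) *
          momentTensor (Aq q - 3) f := by
  have hq0 : 0 < q := by linarith
  have g1 : 0 < Real.Gamma (1 + 1 / q) := Real.Gamma_pos_of_pos (by positivity)
  have gn : 0 < Real.Gamma (1 + n / q) := Real.Gamma_pos_of_pos (by positivity)
  have g4 : 0 < Real.Gamma (1 + (n + 4) / q) := Real.Gamma_pos_of_pos (by positivity)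
  have h := setIntegral_sublevel_one hq0 f
  rw [prod_expMoment_slotCount hq0, mul_comm, ← eq_div_iff g4.ne'] at h
  rw [unifMeasure, integral_smul_measure, volume_lqBall hn hq, lqBall_eq_preimage,
    (PiLp.volume_preserving_ofLp (Fin n)).setIntegral_preimage_emb
      (MeasurableEquiv.toLp 2 (Fin n → ℝ)).symm.measurableEmbedding
      (fun x : Fin n → ℝ => ∏ k, x (f k)), h, ENNReal.toReal_inv,
    ENNReal.toReal_ofReal (by positivity), smul_eq_mul]
  field_simp
  norm_num [mul_comm]

theorem integrable_unifMeasure_lqBall {n : ℕ} (hn : 0 < n) {q : ℝ} (hq : 1 ≤ q)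
    (f : Fin 4 → Fin n) :
    Integrable (fun x => ∏ k, x (f k)) (unifMeasure n (lqBall n q)) := by
  have hq0 : 0 < q := by linarith
  have g1 : 0 < Real.Gamma (1 + 1 / q) := Real.Gamma_pos_of_pos (by positivity)
  have gn : 0 < Real.Gamma (1 + n / q) := Real.Gamma_pos_of_pos (by positivity)
  refine Integrable.smul_measure ?_ ?_
  · rw [lqBall_eq_preimage]
    exact ((PiLp.volume_preserving_ofLp (Fin n)).integrableOn_comp_preimage
      (MeasurableEquiv.toLp 2 (Fin n → ℝ)).symm.measurableEmbedding).2
        (integrableOn_sublevel_one hq0 f)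
  · rw [volume_lqBall hn hq]
    refine ENNReal.inv_ne_top.2 (ENNReal.ofReal_pos.2 ?_).ne'
    positivity

theorem isFiniteMeasure_unifMeasure_lqBall {n : ℕ} (hn : 0 < n) {q : ℝ} (hq : 1 ≤ q) :
    IsFiniteMeasure (unifMeasure n (lqBall n q)) := by
  have hK := volume_lqBall hn hq
  have hq0 : 0 < q := by linarith
  have g1 : 0 < Real.Gamma (1 + 1 / q) := Real.Gamma_pos_of_pos (by positivity)
  have gn : 0 < Real.Gamma (1 + n / q) := Real.Gamma_pos_of_pos (by positivity)
  refine ⟨?_⟩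
  rw [unifMeasure, Measure.smul_apply, Measure.restrict_apply_univ, smul_eq_mul,
    ENNReal.inv_mul_cancel]
  · exact ENNReal.one_lt_top
  · rw [hK]
    exact (ENNReal.ofReal_pos.2 (by positivity)).ne'
  · rw [hK]
    exact ENNReal.ofReal_ne_top

theorem integral_det_pow_four {n : ℕ} (hn : 0 < n) {q : ℝ} (hq : 1 ≤ q) :
    ∫ x : Fin n → EuclideanSpace ℝ (Fin n), (Matrix.of fun i j => x i j).det ^ 4
        ∂(jointUnif n n (lqBall n q)) =
      (Real.Gamma (1 + 3 / q) ^ 2 * Real.Gamma (1 + n / q) /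
        (9 * Real.Gamma (1 + 1 / q) ^ 2 * Real.Gamma (1 + (n + 4) / q))) ^ n *
          fourthMomentPoly n (Aq q - 3) := by
  have := isFiniteMeasure_unifMeasure_lqBall hn hq
  simp only [det_pow_four_eq_sum, Matrix.of_apply, jointUnif]
  rw [integral_finsetSum, ← hyperdet_momentTensor, hyperdet, mul_sum]
  · refine sum_congr rfl fun σ _ => ?_
    rw [integral_const_mul, integral_fintype_prod_eq_prod (𝕜 := ℝ)
      (fun i (y : EuclideanSpace ℝ (Fin n)) => ∏ k, y (σ k i))]
    simp only [integral_unifMeasure_lqBall hn hq, prod_mul_distrib, prod_const, card_univ,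
      Fintype.card_fin]
    ring
  · intro σ _
    refine Integrable.const_mul ?_ _
    exact Integrable.fintype_prod (μ := fun _ : Fin n => unifMeasure n (lqBall n q))
      (f := fun i (y : EuclideanSpace ℝ (Fin n)) => ∏ k, y (σ k i))
      fun i => integrable_unifMeasure_lqBall hn hq _

end

/-- For `1 ≤ q < ∞`,
`𝔼 V_{B_qⁿ}⁴ = ((n+1)(n+2)/(2 (n!)²)) (Γ(1+3/q)² Γ(1+n/q) / (9 Γ(1+1/q)⁶ Γ(1+(n+4)/q)))ⁿ
· Γ(1+n/q)⁴ · φ(A_q − 3, n)`. -/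
theorem fourth_moment_randCrossVol_lqBall
    (n : ℕ) (hn : 0 < n) (q : ℝ) (hq : 1 ≤ q) :
    ∫ x, randCrossVol n (lqBall n q) x ^ 4 ∂(jointUnif n n (lqBall n q)) =
      (((n : ℝ) + 1) * ((n : ℝ) + 2) / (2 * (n.factorial : ℝ) ^ 2)) *
        (Real.Gamma (1 + 3 / q) ^ 2 * Real.Gamma (1 + (n : ℝ) / q) /
            (9 * Real.Gamma (1 + 1 / q) ^ 6 * Real.Gamma (1 + ((n : ℝ) + 4) / q))) ^ n *
        Real.Gamma (1 + (n : ℝ) / q) ^ 4 * phiFn (Aq q - 3) n := by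
  have hq0 : 0 < q := by linarith
  have g1 : 0 < Real.Gamma (1 + 1 / q) := Real.Gamma_pos_of_pos (by positivity)
  have gn : 0 < Real.Gamma (1 + n / q) := Real.Gamma_pos_of_pos (by positivity)
  have g4 : 0 < Real.Gamma (1 + (n + 4) / q) := Real.Gamma_pos_of_pos (by positivity)
  have hV (x : Fin n → EuclideanSpace ℝ (Fin n)) : randCrossVol n (lqBall n q) x ^ 4 =
      (Real.Gamma (1 + n / q) / (n.factorial * Real.Gamma (1 + 1 / q) ^ n)) ^ 4 *
        (Matrix.of fun i j => x i j).det ^ 4 := by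
    rw [randCrossVol, volume_convexHull_range_union_neg hn, volume_lqBall hn hq,
      ENNReal.toReal_ofReal (by positivity), ← (show Even 4 by decide).pow_abs (Matrix.det _),
      ← mul_pow, mul_pow 2]
    congr 1
    field_simp
  simp only [hV]
  rw [integral_const_mul, integral_det_pow_four hn hq, fourthMomentPoly_eq_phiFn]
  simp only [div_pow, mul_pow, ← pow_mul]
  rw [mul_comm n 4, mul_comm 2 n, mul_comm 6 n]
  field_simp
  ring
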